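/- For every cyclic system b of rank n ≥ 2, the set of feasible signed quasi-couplings is nonempty, the infimum defining CNT3(b) is attained by some feasible y, and the supremum defining CNTF(b) is attained by some nonnegative z satisfying the CNTF constraints. -/

import Mathlib

open Finset

/-- Cyclic predecessor `i ⊖ 1` on `Fin n`. -/
def fpred {n : ℕ} (i : Fin n) : Fin n := ⟨(i.val + (n - 1)) % n, Nat.mod_lt _ i.pos⟩

/-- Cyclic successor `i ⊕ 1` on `Fin n`. -/
def fsucc {n : ℕ} (i : Fin n) : Fin n := ⟨(i.val + 1) % n, Nat.mod_lt _ i.pos⟩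

/-- `b` specifies a cyclic system of rank `n`: each bunch distribution is
nonnegative and sums to one. -/
def IsCyclicSystem (n : ℕ) (b : Fin n → Bool → Bool → ℝ) : Prop :=
  (∀ i r r', 0 ≤ b i r r') ∧ ∀ i, (∑ r : Bool, ∑ r' : Bool, b i r r') = 1

/-- Marginal distribution of `R_i^i`. -/
def mFst {n : ℕ} (b : Fin n → Bool → Bool → ℝ) (i : Fin n) (r : Bool) : ℝ :=
  b i r false + b i r true

/-- Marginal distribution of `R_i^{i⊖1}`. -/
def mSnd {n : ℕ} (b : Fin n → Bool → Bool → ℝ) (i : Fin n) (r : Bool) : ℝ :=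
  b (fpred i) false r + b (fpred i) true r

/-- Multimaximal-coupling distribution of connection `i`:
joint distribution of `(T_i^i, T_i^{i⊖1})`. -/
noncomputable def mmc {n : ℕ} (b : Fin n → Bool → Bool → ℝ) (i : Fin n) : Bool → Bool → ℝ :=
  fun r r' =>
    match r, r' with
    | true, true => min (mFst b i true) (mSnd b i true)
    | false, false => min (mFst b i false) (mSnd b i false)
    | true, false => mFst b i true - min (mFst b i true) (mSnd b i true)
    | false, true => mSnd b i true - min (mFst b i true) (mSnd b i true)

/-- Bunch marginal of a signed quasi-coupling `y` at context `i`. -/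
def Bm {n : ℕ} (i : Fin n) (y : (Fin n → Bool × Bool) → ℝ) (r r' : Bool) : ℝ :=
  ∑ s : Fin n → Bool × Bool, if s i = (r, r') then y s else 0

/-- Connection marginal of a signed quasi-coupling `y` at content `i`. -/
def Cm {n : ℕ} (i : Fin n) (y : (Fin n → Bool × Bool) → ℝ) (r r' : Bool) : ℝ :=
  ∑ s : Fin n → Bool × Bool, if (s i).1 = r ∧ (s (fpred i)).2 = r' then y s else 0

/-- `y` is a feasible signed quasi-coupling for the system `b`. -/
def Feasible {n : ℕ} (b : Fin n → Bool → Bool → ℝ) (y : (Fin n → Bool × Bool) → ℝ) : Prop :=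
  ∀ i r r', Bm i y r r' = b i r r' ∧ Cm i y r r' = mmc b i r r'

/-- The quasi-coupling measure of contextuality. -/
noncomputable def CNT3 {n : ℕ} (b : Fin n → Bool → Bool → ℝ) : ℝ :=
  sInf {t : ℝ | ∃ y, Feasible b y ∧ t = ∑ s : Fin n → Bool × Bool, |y s|} - 1

/-- Constraints of the contextual-fraction linear program. -/
def CNTFConstraints {n : ℕ} (b : Fin n → Bool → Bool → ℝ)
    (z : (Fin n → Bool × Bool) → ℝ) : Prop :=
  (∀ s, 0 ≤ z s) ∧ ∀ i r r', Bm i z r r' ≤ b i r r' ∧ Cm i z r r' ≤ mmc b i r r'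

/-- The contextual fraction. -/
noncomputable def CNTF {n : ℕ} (b : Fin n → Bool → Bool → ℝ) : ℝ :=
  1 - sSup {t : ℝ | ∃ z, CNTFConstraints b z ∧ t = ∑ s : Fin n → Bool × Bool, z s}

/-- `b` is noncontextual iff it admits a nonnegative feasible coupling. -/
def Noncontextual {n : ℕ} (b : Fin n → Bool → Bool → ℝ) : Prop :=
  ∃ y, Feasible b y ∧ ∀ s, 0 ≤ y s

/-- On a `Fin n` with at least two elements the cyclic predecessor has no fixed point. -/
lemma fpred_ne {n : ℕ} (hn : 2 ≤ n) (i : Fin n) : fpred i ≠ i := by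
  intro h
  have h1 : (i.val + (n - 1)) % n = i.val := congrArg Fin.val h
  have hi := i.isLt
  rcases Nat.eq_zero_or_pos i.val with h0 | h0
  · rw [h0, Nat.mod_eq_of_lt (by omega)] at h1
    omega
  · rw [show i.val + (n - 1) = (i.val - 1) + n by omega, Nat.add_mod_right,
      Nat.mod_eq_of_lt (by omega)] at h1
    omega

lemma sum_ite_forall_prod {ι α : Type*} [Fintype ι] [DecidableEq ι] [Fintype α]
    (f : ι → α → ℝ) (p : ι → α → Prop) [∀ k, DecidablePred (p k)] :
    (∑ s : ι → α, if ∀ k, p k (s k) then ∏ k, f k (s k) else 0) =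
      ∏ k, ∑ a, if p k a then f k a else 0 := by
  rw [Finset.prod_univ_sum, Fintype.piFinset_univ]
  refine Finset.sum_congr rfl fun s _ => ?_
  rw [Finset.prod_ite_zero]
  simp

/-- The bunch marginals of a product function factor over the contexts. -/
lemma Bm_prod {n : ℕ} (i : Fin n) (f : Fin n → Bool × Bool → ℝ) (r r' : Bool) :
    Bm i (fun s => ∏ k, f k (s k)) r r' =
      ∏ k, ∑ a, if k = i → a = (r, r') then f k a else 0 := by
  rw [← sum_ite_forall_prod f fun k a => k = i → a = (r, r')]
  simp only [Bm, forall_eq]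

/-- The connection marginals of a product function factor over the contexts. -/
lemma Cm_prod {n : ℕ} (i : Fin n) (f : Fin n → Bool × Bool → ℝ) (r r' : Bool) :
    Cm i (fun s => ∏ k, f k (s k)) r r' =
      ∏ k, ∑ a, if (k = i → a.1 = r) ∧ (k = fpred i → a.2 = r') then f k a else 0 := by
  rw [← sum_ite_forall_prod f fun k a => (k = i → a.1 = r) ∧ (k = fpred i → a.2 = r')]
  simp only [Cm, forall_and, forall_eq]

lemma Bm_add {n : ℕ} (i : Fin n) (y z : (Fin n → Bool × Bool) → ℝ) (r r' : Bool) :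
    Bm i (y + z) r r' = Bm i y r r' + Bm i z r r' := by
  simp only [Bm, ← Finset.sum_add_distrib, Pi.add_apply]
  exact Finset.sum_congr rfl fun s _ => by split_ifs <;> simp

lemma Cm_add {n : ℕ} (i : Fin n) (y z : (Fin n → Bool × Bool) → ℝ) (r r' : Bool) :
    Cm i (y + z) r r' = Cm i y r r' + Cm i z r r' := by
  simp only [Cm, ← Finset.sum_add_distrib, Pi.add_apply]
  exact Finset.sum_congr rfl fun s _ => by split_ifs <;> simp

lemma Bm_sum_smul {n : ℕ} {ι : Type*} (t : Finset ι) (i : Fin n) (c : ι → ℝ)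
    (g : ι → (Fin n → Bool × Bool) → ℝ) (r r' : Bool) :
    Bm i (fun s => ∑ j ∈ t, c j * g j s) r r' = ∑ j ∈ t, c j * Bm i (g j) r r' := by
  simp only [Bm, Finset.mul_sum]
  rw [Finset.sum_comm]
  exact Finset.sum_congr rfl fun s _ => by split_ifs <;> simp

lemma Cm_sum_smul {n : ℕ} {ι : Type*} (t : Finset ι) (i : Fin n) (c : ι → ℝ)
    (g : ι → (Fin n → Bool × Bool) → ℝ) (r r' : Bool) :
    Cm i (fun s => ∑ j ∈ t, c j * g j s) r r' = ∑ j ∈ t, c j * Cm i (g j) r r' := by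
  simp only [Cm, Finset.mul_sum]
  rw [Finset.sum_comm]
  exact Finset.sum_congr rfl fun s _ => by split_ifs <;> simp

/-- The nontrivial character of `Bool`. -/
def boolSign (r : Bool) : ℝ := if r then 1 else -1

/-- The context factors of the perturbation that changes the correlation of connection `i`
and no other bunch or connection marginal. -/
def connFactor {n : ℕ} (i k : Fin n) (a : Bool × Bool) : ℝ :=
  if k = i then (if a.2 then boolSign a.1 else 0)
  else if k = fpred i then (if a.1 then boolSign a.2 else 0)
  else if a = (true, true) then 1 else 0

lemma Bm_connFactor {n : ℕ} (hn : 2 ≤ n) (i j : Fin n) (r r' : Bool) :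
    Bm j (fun s => ∏ k, connFactor i k (s k)) r r' = 0 := by
  have hp := fpred_ne hn i
  rw [Bm_prod]
  by_cases hij : i = j
  · subst hij
    refine Finset.prod_eq_zero (Finset.mem_univ (fpred i)) ?_
    simp [connFactor, boolSign, hp, Fintype.sum_prod_type]
  · refine Finset.prod_eq_zero (Finset.mem_univ i) ?_
    simp [connFactor, boolSign, hij, Fintype.sum_prod_type]

lemma Cm_connFactor_of_ne {n : ℕ} {i j : Fin n} (hij : i ≠ j) (r r' : Bool) :
    Cm j (fun s => ∏ k, connFactor i k (s k)) r r' = 0 := by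
  rw [Cm_prod]
  refine Finset.prod_eq_zero (Finset.mem_univ i) ?_
  by_cases hp : i = fpred j
  · subst hp
    cases r' <;> simp [connFactor, boolSign, hij, Fintype.sum_prod_type]
  · simp [connFactor, boolSign, hij, hp, Fintype.sum_prod_type]

lemma Cm_connFactor_self {n : ℕ} (hn : 2 ≤ n) (i : Fin n) (r r' : Bool) :
    Cm i (fun s => ∏ k, connFactor i k (s k)) r r' = boolSign r * boolSign r' := by
  have hp := fpred_ne hn i
  rw [Cm_prod, Finset.prod_eq_mul i (fpred i) hp.symm]
  · cases r <;> cases r' <;> simp [connFactor, boolSign, hp, hp.symm, Fintype.sum_prod_type]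
  · rintro k - ⟨h1, h2⟩
    simp [connFactor, h1, h2]
  all_goals simp

lemma IsCyclicSystem.sum_eq_one {n : ℕ} {b : Fin n → Bool → Bool → ℝ} (hb : IsCyclicSystem n b)
    (i : Fin n) : ∑ a : Bool × Bool, b i a.1 a.2 = 1 := by
  rw [Fintype.sum_prod_type]
  exact hb.2 i

lemma Bm_bunch_prod {n : ℕ} {b : Fin n → Bool → Bool → ℝ} (hb : IsCyclicSystem n b)
    (i : Fin n) (r r' : Bool) :
    Bm i (fun s => ∏ k, b k (s k).1 (s k).2) r r' = b i r r' := by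
  rw [Bm_prod i fun k a => b k a.1 a.2, Finset.prod_eq_single i]
  · simp
  · intro k _ hk
    simp [hk, hb.sum_eq_one]
  · simp

lemma Cm_bunch_prod {n : ℕ} (hn : 2 ≤ n) {b : Fin n → Bool → Bool → ℝ} (hb : IsCyclicSystem n b)
    (i : Fin n) (r r' : Bool) :
    Cm i (fun s => ∏ k, b k (s k).1 (s k).2) r r' = mFst b i r * mSnd b i r' := by
  have hp := fpred_ne hn i
  rw [Cm_prod i fun k a => b k a.1 a.2, Finset.prod_eq_mul i (fpred i) hp.symm]
  · cases r <;> cases r' <;>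
      simp [mFst, mSnd, hp, hp.symm, Fintype.sum_prod_type, add_comm]
  · rintro k - ⟨h1, h2⟩
    simp [h1, h2, hb.sum_eq_one]
  all_goals simp

lemma mFst_add {n : ℕ} {b : Fin n → Bool → Bool → ℝ} (hb : IsCyclicSystem n b) (i : Fin n) :
    mFst b i true + mFst b i false = 1 := by
  have := hb.2 i
  simp only [Fintype.sum_bool] at this
  simp only [mFst]
  linarith

lemma mSnd_add {n : ℕ} {b : Fin n → Bool → Bool → ℝ} (hb : IsCyclicSystem n b) (i : Fin n) :
    mSnd b i true + mSnd b i false = 1 := by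
  have := hb.2 (fpred i)
  simp only [Fintype.sum_bool] at this
  simp only [mSnd]
  linarith

/-- The multimaximal coupling has the same marginals as the product coupling, so the two differ
by a multiple of the product of characters. -/
lemma mmc_eq {n : ℕ} {b : Fin n → Bool → Bool → ℝ} (hb : IsCyclicSystem n b) (i : Fin n)
    (r r' : Bool) :
    mmc b i r r' = mFst b i r * mSnd b i r' +
      (mmc b i true true - mFst b i true * mSnd b i true) * (boolSign r * boolSign r') := by
  have hF : mFst b i false = 1 - mFst b i true := by linarith [mFst_add hb i]
  have hS : mSnd b i false = 1 - mSnd b i true := by linarith [mSnd_add hb i]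
  have hmin : min (1 - mFst b i true) (1 - mSnd b i true) =
      1 - mFst b i true - mSnd b i true + min (mFst b i true) (mSnd b i true) := by
    rcases le_total (mFst b i true) (mSnd b i true) with h | h
    · rw [min_eq_left h, min_eq_right (by linarith)]; ring
    · rw [min_eq_right h, min_eq_left (by linarith)]; ring
  cases r <;> cases r' <;> simp [mmc, boolSign, hF, hS, hmin] <;> ring

lemma mmc_nonneg {n : ℕ} {b : Fin n → Bool → Bool → ℝ} (hb : IsCyclicSystem n b) (i : Fin n)
    (r r' : Bool) : 0 ≤ mmc b i r r' := by
  have hF : ∀ r, 0 ≤ mFst b i r := fun r => add_nonneg (hb.1 _ _ _) (hb.1 _ _ _)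
  have hS : ∀ r, 0 ≤ mSnd b i r := fun r => add_nonneg (hb.1 _ _ _) (hb.1 _ _ _)
  cases r <;> cases r' <;> simp [mmc, hF, hS]

lemma exists_feasible {n : ℕ} (hn : 2 ≤ n) {b : Fin n → Bool → Bool → ℝ}
    (hb : IsCyclicSystem n b) : ∃ y, Feasible b y := by
  refine ⟨(fun s => ∏ k, b k (s k).1 (s k).2) + fun s => ∑ j,
    (mmc b j true true - mFst b j true * mSnd b j true) * ∏ k, connFactor j k (s k),
    fun i r r' => ⟨?_, ?_⟩⟩
  · rw [Bm_add, Bm_bunch_prod hb,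
      Bm_sum_smul _ _ _ fun j s => ∏ k, connFactor j k (s k)]
    simp [Bm_connFactor hn]
  · rw [Cm_add, Cm_bunch_prod hn hb,
      Cm_sum_smul _ _ _ fun j s => ∏ k, connFactor j k (s k), mmc_eq hb i r r',
      Finset.sum_eq_single i, Cm_connFactor_self hn]
    · intro j _ hj
      rw [Cm_connFactor_of_ne hj, mul_zero]
    · simp

lemma continuous_Bm {n : ℕ} (i : Fin n) (r r' : Bool) : Continuous fun y => Bm i y r r' := by
  refine continuous_finsetSum _ fun s _ => ?_
  split_ifs <;> fun_prop

lemma continuous_Cm {n : ℕ} (i : Fin n) (r r' : Bool) : Continuous fun y => Cm i y r r' := by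
  refine continuous_finsetSum _ fun s _ => ?_
  split_ifs <;> fun_prop

lemma isClosed_feasible {n : ℕ} (b : Fin n → Bool → Bool → ℝ) : IsClosed {y | Feasible b y} := by
  simp only [Feasible, Set.ofPred_forall, Set.ofPred_and]
  exact isClosed_iInter fun i => isClosed_iInter fun r => isClosed_iInter fun r' =>
    (isClosed_eq (continuous_Bm i r r') continuous_const).inter
      (isClosed_eq (continuous_Cm i r r') continuous_const)

lemma isClosed_CNTFConstraints {n : ℕ} (b : Fin n → Bool → Bool → ℝ) :
    IsClosed {z | CNTFConstraints b z} := by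
  simp only [CNTFConstraints, Set.ofPred_forall, Set.ofPred_and]
  refine IsClosed.inter (isClosed_iInter fun s => isClosed_le continuous_const
    (continuous_apply s)) ?_
  exact isClosed_iInter fun i => isClosed_iInter fun r => isClosed_iInter fun r' =>
    (isClosed_le (continuous_Bm i r r') continuous_const).inter
      (isClosed_le (continuous_Cm i r r') continuous_const)

/-- On a nonempty closed set of vectors the `ℓ¹` norm attains its minimum. -/
lemma exists_isLeast_sum_abs {σ : Type*} [Fintype σ] {S : Set (σ → ℝ)} (hS : IsClosed S)
    (hne : S.Nonempty) : ∃ y ∈ S, ∀ w ∈ S, ∑ s, |y s| ≤ ∑ s, |w s| := by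
  obtain ⟨y₀, h₀⟩ := hne
  set L := ∑ s, |y₀ s|
  have hcont : Continuous fun y : σ → ℝ => ∑ s, |y s| := by fun_prop
  have hK : IsCompact (S ∩ {y | ∑ s, |y s| ≤ L}) := by
    refine (isCompact_Icc (a := fun _ : σ => -L) (b := fun _ => L)).of_isClosed_subset
      (hS.inter (isClosed_le hcont continuous_const)) ?_
    rintro y ⟨-, hy⟩
    have h : ∀ s, |y s| ≤ L := fun s =>
      (Finset.single_le_sum (f := fun s => |y s|) (fun s _ => abs_nonneg _)
        (Finset.mem_univ s)).trans hy
    exact ⟨fun s => (abs_le.1 (h s)).1, fun s => (abs_le.1 (h s)).2⟩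
  obtain ⟨y, hy, hmin⟩ := hK.exists_isMinOn ⟨y₀, h₀, le_refl L⟩ hcont.continuousOn
  refine ⟨y, hy.1, fun w hw => ?_⟩
  rcases le_total (∑ s, |w s|) L with h | h
  · exact hmin ⟨hw, h⟩
  · exact le_trans hy.2 h

lemma isCompact_CNTFConstraints {n : ℕ} (i : Fin n) (b : Fin n → Bool → Bool → ℝ) :
    IsCompact {z | CNTFConstraints b z} := by
  refine (isCompact_Icc (a := 0) (b := fun s => b i (s i).1 (s i).2)).of_isClosed_subset
    (isClosed_CNTFConstraints b) ?_
  rintro z ⟨hz, hm⟩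
  refine ⟨hz, fun s => le_trans ?_ (hm i (s i).1 (s i).2).1⟩
  have := Finset.single_le_sum (f := fun t => if t i = ((s i).1, (s i).2) then z t else 0)
    (fun t _ => by split_ifs <;> simp [hz]) (Finset.mem_univ s)
  simpa [Bm] using this

/-- For every cyclic system of rank `n ≥ 2`, feasible quasi-couplings exist,
the infimum defining `CNT3` is attained, and the supremum defining `CNTF` is attained. -/
theorem programs_attained (n : ℕ) (hn : 2 ≤ n)
    (b : Fin n → Bool → Bool → ℝ) (hb : IsCyclicSystem n b) :
    (∃ y : (Fin n → Bool × Bool) → ℝ, Feasible b y) ∧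
    (∃ y : (Fin n → Bool × Bool) → ℝ, Feasible b y ∧ (∑ s, |y s|) = 1 + CNT3 b) ∧
    (∃ z : (Fin n → Bool × Bool) → ℝ, CNTFConstraints b z ∧ (∑ s, z s) = 1 - CNTF b) := by
  have hne := exists_feasible hn hb
  refine ⟨hne, ?_, ?_⟩
  · obtain ⟨y, hy, hmin⟩ := exists_isLeast_sum_abs (isClosed_feasible b) hne
    have hleast : IsLeast {t : ℝ | ∃ y, Feasible b y ∧ t = ∑ s, |y s|} (∑ s, |y s|) :=
      ⟨⟨y, hy, rfl⟩, by rintro _ ⟨w, hw, rfl⟩; exact hmin w hw⟩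
    exact ⟨y, hy, by rw [CNT3, hleast.csInf_eq]; ring⟩
  · have hzero : CNTFConstraints b 0 :=
      ⟨fun s => le_rfl, fun i r r' =>
        ⟨by simpa [Bm] using hb.1 i r r', by simpa [Cm] using mmc_nonneg hb i r r'⟩⟩
    have hcont : Continuous fun z : (Fin n → Bool × Bool) → ℝ => ∑ s, z s := by fun_prop
    obtain ⟨z, hz, hmax⟩ := (isCompact_CNTFConstraints ⟨0, by omega⟩ b).exists_isMaxOn
      ⟨0, hzero⟩ hcont.continuousOn
    have hgreatest : IsGreatest {t : ℝ | ∃ z, CNTFConstraints b z ∧ t = ∑ s, z s} (∑ s, z s) :=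
      ⟨⟨z, hz, rfl⟩, by rintro _ ⟨w, hw, rfl⟩; exact hmax hw⟩
    exact ⟨z, hz, by rw [CNTF, hgreatest.csSup_eq]; ring⟩
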